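/- Let A, B, E ⊆ ℝ be Lebesgue measurable sets with finite, positive measures and let D = D(A,B,E) be the Riesz–Sobolev deficit. Suppose ||A|−|B|| + 2D^{1/2} < |E| < |A| + |B| − 2D^{1/2}. Define τ by |E| = |A| + |B| − 2τ. Then |S_{A,B}(τ) △ E| ≤ 4 D^{1/2} and ||S_{A,B}(τ)| − (|A| + |B| − 2τ)| ≤ 4 D^{1/2}. -/

import Mathlib

open MeasureTheory Set Pointwise

/-- Lebesgue measure of a set of reals, as a real number. -/
noncomputable def lm (S : Set ℝ) : ℝ := (MeasureTheory.volume S).toReal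

/-- Convolution of indicator functions: `(1_A ∗ 1_B)(x) = ∫ 1_A(y) 1_B(x−y) dy`. -/
noncomputable def cv (A B : Set ℝ) (x : ℝ) : ℝ :=
  ∫ y, A.indicator (1 : ℝ → ℝ) y * B.indicator (1 : ℝ → ℝ) (x - y)

/-- The pairing `⟨1_A ∗ 1_B, 1_C⟩ = ∫ (1_A ∗ 1_B) · 1_C`. -/
noncomputable def pr (A B C : Set ℝ) : ℝ := ∫ x, cv A B x * C.indicator (1 : ℝ → ℝ) x

/-- The symmetric rearrangement `S⋆`: the open interval centered at 0 with `|S⋆| = |S|`. -/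
noncomputable def sstar (S : Set ℝ) : Set ℝ := Set.Ioo (-(lm S / 2)) (lm S / 2)

/-- The Riesz–Sobolev deficit `D(A,B,C) = ⟨1_{A⋆}∗1_{B⋆},1_{C⋆}⟩ − ⟨1_A∗1_B,1_C⟩`. -/
noncomputable def rsD (A B C : Set ℝ) : ℝ := pr (sstar A) (sstar B) (sstar C) - pr A B C

/-- The superlevel set `S_{A,B}(t) = {x : (1_A ∗ 1_B)(x) > t}`. -/
def slev (A B : Set ℝ) (t : ℝ) : Set ℝ := {x | cv A B x > t}

/-- The KPRGT deficit `D′(A,B,τ) = (|A|−τ)(|B|−τ) − ∫_τ^∞ |S_{A,B}(t)| dt`. -/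
noncomputable def kD (A B : Set ℝ) (τ : ℝ) : ℝ :=
  (lm A - τ) * (lm B - τ) - ∫ t in Set.Ioi τ, lm (slev A B t)

/-- `η`-strict admissibility of the ordered triple `(A,B,C)`:
`|X| + |Y| ≥ |Z| + η·max(|A|,|B|,|C|)` for every permutation `(X,Y,Z)` of `(A,B,C)`. -/
def adm (η : ℝ) (A B C : Set ℝ) : Prop :=
  lm A + lm B ≥ lm C + η * max (lm A) (max (lm B) (lm C)) ∧
  lm A + lm C ≥ lm B + η * max (lm A) (max (lm B) (lm C)) ∧
  lm B + lm C ≥ lm A + η * max (lm A) (max (lm B) (lm C))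

open Filter Topology

theorem lm_mono {S T : Set ℝ} (h : S ⊆ T) (hT : volume T ≠ ⊤) : lm S ≤ lm T :=
  ENNReal.toReal_mono hT (measure_mono h)

theorem lm_union_le (S T : Set ℝ) : lm (S ∪ T) ≤ lm S + lm T :=
  measureReal_union_le S T

theorem lm_Ioo (x y : ℝ) : lm (Ioo x y) = max (y - x) 0 := by
  rw [lm, Real.volume_Ioo, ENNReal.toReal_ofReal']

/-- The convolution of indicators as the measure of an intersection with a reflected translate. -/
theorem cv_eq_lm {A B : Set ℝ} (hA : MeasurableSet A) (hB : MeasurableSet B) (x : ℝ) :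
    cv A B x = lm (A ∩ (fun y => x - y) ⁻¹' B) := by
  have hm : MeasurableSet (A ∩ (fun y => x - y) ⁻¹' B) :=
    hA.inter (hB.preimage (measurable_const.sub measurable_id))
  rw [lm, ← measureReal_def, ← integral_indicator_one hm, cv]
  congr 1
  ext y
  by_cases h1 : y ∈ A <;> by_cases h2 : x - y ∈ B <;> simp [indicator, h1, h2]

theorem cv_nonneg (A B : Set ℝ) (x : ℝ) : 0 ≤ cv A B x :=
  integral_nonneg fun _ => mul_nonneg (indicator_nonneg (fun _ _ => zero_le_one) _)
    (indicator_nonneg (fun _ _ => zero_le_one) _)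

theorem integrable_indicator_one_of_measure_ne_top {A : Set ℝ} (hA : MeasurableSet A)
    (hAf : volume A ≠ ⊤) : Integrable (A.indicator (1 : ℝ → ℝ)) :=
  (integrable_indicator_iff hA).2 (integrableOn_const hAf)

theorem mul_indicator_one_eq_indicator (f : ℝ → ℝ) (E : Set ℝ) :
    (fun x => f x * E.indicator (1 : ℝ → ℝ) x) = E.indicator f := by
  ext x
  by_cases hx : x ∈ E <;> simp [hx]

theorem cv_integrable {A B : Set ℝ} (hA : MeasurableSet A) (hB : MeasurableSet B)
    (hAf : volume A ≠ ⊤) (hBf : volume B ≠ ⊤) : Integrable (cv A B) :=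
  (integrable_indicator_one_of_measure_ne_top hA hAf).integrable_convolution
    (ContinuousLinearMap.mul ℝ ℝ) (integrable_indicator_one_of_measure_ne_top hB hBf)

theorem integral_cv {A B : Set ℝ} (hA : MeasurableSet A) (hB : MeasurableSet B)
    (hAf : volume A ≠ ⊤) (hBf : volume B ≠ ⊤) : ∫ x, cv A B x = lm A * lm B := by
  have h := integral_convolution (ContinuousLinearMap.mul ℝ ℝ)
    (integrable_indicator_one_of_measure_ne_top hA hAf)
    (integrable_indicator_one_of_measure_ne_top hB hBf)
  rw [integral_indicator_one hA, integral_indicator_one hB] at h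
  exact h

theorem measurable_cv {A B : Set ℝ} (hA : MeasurableSet A) (hB : MeasurableSet B) :
    Measurable (cv A B) := by
  have h : StronglyMeasurable fun p : ℝ × ℝ =>
      A.indicator (1 : ℝ → ℝ) p.2 * B.indicator (1 : ℝ → ℝ) (p.1 - p.2) :=
    (((measurable_one.indicator hA).comp measurable_snd).mul
      ((measurable_one.indicator hB).comp (measurable_fst.sub measurable_snd))).stronglyMeasurable
  exact h.integral_prod_right.measurable

/-- A set of finite measure can be cut by a half-line so that the left part has any prescribed
measure. -/
theorem exists_lm_inter_Iic_eq {A : Set ℝ} (hAf : volume A ≠ ⊤) {t : ℝ}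
    (h0 : 0 < t) (h1 : t < lm A) : ∃ c, lm (A ∩ Iic c) = t := by
  have : IsFiniteMeasure (volume.restrict A) := ⟨by simpa using hAf.lt_top⟩
  have hF (x : ℝ) : lm (A ∩ Iic x) = (volume.restrict A (Iic x)).toReal := by
    rw [lm, Measure.restrict_apply measurableSet_Iic, inter_comm]
  have hlip : LipschitzWith 1 fun x => lm (A ∩ Iic x) := by
    refine LipschitzWith.of_le_add fun x y => ?_
    have hsub : A ∩ Iic x ⊆ (A ∩ Iic y) ∪ Ioc y x := by
      rintro z ⟨hz, hzx⟩
      rcases le_or_gt z y with h | h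
      · exact Or.inl ⟨hz, h⟩
      · exact Or.inr ⟨h, hzx⟩
    have hfin : volume ((A ∩ Iic y) ∪ Ioc y x) ≠ ⊤ :=
      measure_union_ne_top (measure_ne_top_of_subset inter_subset_left hAf)
        measure_Ioc_lt_top.ne
    have hI : lm (Ioc y x) ≤ dist x y := by
      rw [lm, Real.volume_Ioc, ENNReal.toReal_ofReal', Real.dist_eq]
      exact max_le (le_abs_self _) (abs_nonneg _)
    linarith [lm_mono hsub hfin, lm_union_le (A ∩ Iic y) (Ioc y x)]
  have hbot : Tendsto (fun x => lm (A ∩ Iic x)) atBot (𝓝 0) := by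
    simp_rw [hF]
    have h := tendsto_measure_iInter_atBot (μ := volume.restrict A) (s := fun x : ℝ => Iic x)
      (fun _ => measurableSet_Iic.nullMeasurableSet) (fun _ _ h => Iic_subset_Iic.2 h)
      ⟨0, measure_ne_top _ _⟩
    rw [iInter_Iic_eq_empty_iff.2 (by simp), measure_empty] at h
    exact (ENNReal.tendsto_toReal ENNReal.zero_ne_top).comp h
  have htop : Tendsto (fun x => lm (A ∩ Iic x)) atTop (𝓝 (lm A)) := by
    simp_rw [hF]
    have h := (ENNReal.tendsto_toReal (measure_ne_top (volume.restrict A) univ)).comp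
      (tendsto_measure_Iic_atTop (volume.restrict A))
    rw [Measure.restrict_apply_univ] at h
    exact h
  obtain ⟨u, hu⟩ := (hbot.eventually (gt_mem_nhds h0)).exists
  obtain ⟨v, hv⟩ := (htop.eventually (lt_mem_nhds h1)).exists
  exact mem_range_of_exists_le_of_exists_ge hlip.continuous ⟨u, hu.le⟩ ⟨v, hv.le⟩

theorem lm_inter_add_diff {A C : Set ℝ} (hC : MeasurableSet C) (hAf : volume A ≠ ⊤) :
    lm (A ∩ C) + lm (A \ C) = lm A :=
  measureReal_inter_add_sdiff hC hAf

/-- The convolution of indicators exceeds the level `t` by at most the convolution of the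
indicators of suitable subsets of measures `|A| - t` and `|B| - t`. This is the
Pollard–Kemperman inequality on the line in pointwise form. -/
theorem exists_cv_le_add_cv {A B : Set ℝ} (hA : MeasurableSet A) (hB : MeasurableSet B)
    (hAf : volume A ≠ ⊤) (hBf : volume B ≠ ⊤) {t : ℝ} (h0 : 0 < t) (hAt : t < lm A)
    (hBt : t < lm B) :
    ∃ h : ℝ → ℝ, Integrable h ∧ (∀ x, 0 ≤ h x) ∧ (∀ x, cv A B x ≤ t + h x) ∧
      ∫ x, h x = (lm A - t) * (lm B - t) := by
  obtain ⟨c, hc⟩ := exists_lm_inter_Iic_eq hAf h0 hAt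
  obtain ⟨d, hd⟩ := exists_lm_inter_Iic_eq hBf (t := lm B - t) (by linarith) (by linarith)
  have hAd := lm_inter_add_diff (measurableSet_Iic (a := c)) hAf
  have hBd := lm_inter_add_diff (measurableSet_Iic (a := d)) hBf
  have hA' : MeasurableSet (A \ Iic c) := hA.diff measurableSet_Iic
  have hB' : MeasurableSet (B ∩ Iic d) := hB.inter measurableSet_Iic
  have hAf' : volume (A \ Iic c) ≠ ⊤ := measure_ne_top_of_subset sdiff_subset hAf
  have hBf' : volume (B ∩ Iic d) ≠ ⊤ := measure_ne_top_of_subset inter_subset_left hBf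
  refine ⟨cv (A \ Iic c) (B ∩ Iic d), cv_integrable hA' hB' hAf' hBf', cv_nonneg _ _,
    fun x => ?_, ?_⟩
  · rw [cv_eq_lm hA hB, cv_eq_lm hA' hB']
    have hrefl : volume ((fun y => x - y) ⁻¹' (B \ Iic d)) = volume (B \ Iic d) :=
      (Measure.measurePreserving_sub_left volume x).measure_preimage
        (hB.diff measurableSet_Iic).nullMeasurableSet
    have hBd' : lm ((fun y => x - y) ⁻¹' (B \ Iic d)) = t := by
      rw [lm, hrefl, ← lm]; linarith
    have hfin : volume ((A \ Iic c) ∩ (fun y => x - y) ⁻¹' (B ∩ Iic d)) ≠ ⊤ :=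
      measure_ne_top_of_subset inter_subset_left hAf'
    rcases le_or_gt (x - d) c with hxc | hxc
    · have hsub : A ∩ (fun y => x - y) ⁻¹' B ⊆
          (A ∩ Iic c) ∪ ((A \ Iic c) ∩ (fun y => x - y) ⁻¹' (B ∩ Iic d)) := by
        rintro y ⟨hyA, hyB⟩
        rcases le_or_gt y c with h | h
        · exact Or.inl ⟨hyA, h⟩
        · exact Or.inr ⟨⟨hyA, not_le.2 h⟩, hyB, show x - y ≤ d by linarith⟩
      have h := lm_mono hsub (measure_union_ne_top
        (measure_ne_top_of_subset inter_subset_left hAf) hfin)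
      linarith [lm_union_le (A ∩ Iic c) ((A \ Iic c) ∩ (fun y => x - y) ⁻¹' (B ∩ Iic d))]
    · have hsub : A ∩ (fun y => x - y) ⁻¹' B ⊆ ((fun y => x - y) ⁻¹' (B \ Iic d)) ∪
          ((A \ Iic c) ∩ (fun y => x - y) ⁻¹' (B ∩ Iic d)) := by
        rintro y ⟨hyA, hyB⟩
        rcases le_or_gt (x - y) d with h | h
        · by_cases hyc : y ≤ c
          · linarith
          · exact Or.inr ⟨⟨hyA, hyc⟩, hyB, h⟩
        · exact Or.inl ⟨hyB, not_le.2 h⟩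
      have h := lm_mono hsub (measure_union_ne_top
        (hrefl ▸ measure_ne_top_of_subset sdiff_subset hBf) hfin)
      linarith [lm_union_le ((fun y => x - y) ⁻¹' (B \ Iic d))
        ((A \ Iic c) ∩ (fun y => x - y) ⁻¹' (B ∩ Iic d))]
  · rw [integral_cv hA' hB' hAf' hBf', hd]
    congr 1
    linarith

theorem volume_sstar_ne_top (S : Set ℝ) : volume (sstar S) ≠ ⊤ := measure_Ioo_lt_top.ne

theorem lm_sstar (S : Set ℝ) : lm (sstar S) = lm S := by
  rw [sstar, lm_Ioo, sub_neg_eq_add, add_halves]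
  exact max_eq_left ENNReal.toReal_nonneg

theorem cv_sstar_le (A B : Set ℝ) (x : ℝ) :
    cv (sstar A) (sstar B) x ≤ max ((lm A + lm B) / 2 - |x|) 0 := by
  rw [cv_eq_lm (A := sstar A) (B := sstar B) measurableSet_Ioo measurableSet_Ioo]
  rcases le_total 0 x with hx | hx
  · have hsub : sstar A ∩ (fun y => x - y) ⁻¹' sstar B ⊆ Ioo (x - lm B / 2) (lm A / 2) := by
      rintro y ⟨⟨_, h2⟩, h3, h4⟩
      exact ⟨by simp only at h4; linarith, h2⟩
    refine (lm_mono hsub measure_Ioo_lt_top.ne).trans ?_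
    rw [lm_Ioo, abs_of_nonneg hx]
    exact max_le_max (by linarith) le_rfl
  · have hsub : sstar A ∩ (fun y => x - y) ⁻¹' sstar B ⊆ Ioo (-(lm A / 2)) (x + lm B / 2) := by
      rintro y ⟨⟨h1, _⟩, h3, h4⟩
      exact ⟨h1, by simp only at h3; linarith⟩
    refine (lm_mono hsub measure_Ioo_lt_top.ne).trans ?_
    rw [lm_Ioo, abs_of_nonpos hx]
    exact max_le_max (by linarith) le_rfl

theorem pr_sstar_ge {A B E : Set ℝ} {τ : ℝ} (h0 : 0 ≤ τ)
    (hτ : lm E = lm A + lm B - 2 * τ) :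
    lm A * lm B - τ ^ 2 ≤ pr (sstar A) (sstar B) (sstar E) := by
  set m := (lm A + lm B) / 2 with hm
  have hle : m - τ ≤ m := by linarith
  have hle' : -m ≤ -(m - τ) := by linarith
  set w : ℝ → ℝ := fun x =>
    (Icc (m - τ) m).indicator (fun y => m - y) x +
      (Icc (-m) (-(m - τ))).indicator (fun y => m + y) x with hw
  have hi1 : Integrable ((Icc (m - τ) m).indicator fun y => m - y) :=
    (integrable_indicator_iff measurableSet_Icc).2
      (Continuous.integrableOn_Icc (by fun_prop))
  have hi2 : Integrable ((Icc (-m) (-(m - τ))).indicator fun y => m + y) :=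
    (integrable_indicator_iff measurableSet_Icc).2
      (Continuous.integrableOn_Icc (by fun_prop))
  have hv1 : ∫ x, (Icc (m - τ) m).indicator (fun y => m - y) x = τ ^ 2 / 2 := by
    rw [integral_indicator measurableSet_Icc, integral_Icc_eq_integral_Ioc,
      ← intervalIntegral.integral_of_le hle]
    rw [intervalIntegral.integral_sub (by simp) (by simp), integral_id]
    simp
    ring
  have hv2 : ∫ x, (Icc (-m) (-(m - τ))).indicator (fun y => m + y) x = τ ^ 2 / 2 := by
    rw [integral_indicator measurableSet_Icc, integral_Icc_eq_integral_Ioc,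
      ← intervalIntegral.integral_of_le hle']
    rw [intervalIntegral.integral_add (by simp) (by simp), integral_id]
    simp
    ring
  have hf := cv_integrable (A := sstar A) (B := sstar B) measurableSet_Ioo measurableSet_Ioo
    (volume_sstar_ne_top A) (volume_sstar_ne_top B)
  have hint := integral_cv (A := sstar A) (B := sstar B) measurableSet_Ioo measurableSet_Ioo
    (volume_sstar_ne_top A) (volume_sstar_ne_top B)
  rw [lm_sstar, lm_sstar] at hint
  have hpt (x : ℝ) : cv (sstar A) (sstar B) x ≤
      (cv (sstar A) (sstar B) x * (sstar E).indicator (1 : ℝ → ℝ) x) + w x := by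
    have hn1 : 0 ≤ (Icc (m - τ) m).indicator (fun y => m - y) x :=
      indicator_nonneg (fun y hy => sub_nonneg.2 hy.2) x
    have hn2 : 0 ≤ (Icc (-m) (-(m - τ))).indicator (fun y => m + y) x :=
      indicator_nonneg (fun y hy => by linarith [hy.1]) x
    by_cases hx : x ∈ sstar E
    · simp only [indicator_of_mem hx, Pi.one_apply, mul_one, hw]
      linarith
    · simp only [indicator_of_notMem hx, mul_zero, zero_add, hw]
      have hout : m - τ ≤ |x| := by
        by_contra! hlt
        exact hx ⟨by linarith [neg_abs_le x], by linarith [le_abs_self x]⟩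
      refine (cv_sstar_le A B x).trans (max_le ?_ (by linarith))
      rw [← hm]
      rcases lt_or_ge m |x| with hbig | hsmall
      · linarith
      · rcases abs_cases x with ⟨hx1, hx2⟩ | ⟨hx1, hx2⟩
        · rw [indicator_of_mem (show x ∈ Icc (m - τ) m from ⟨by linarith, by linarith⟩)]
          linarith
        · rw [indicator_of_mem (show x ∈ Icc (-m) (-(m - τ)) from ⟨by linarith, by linarith⟩)]
          linarith
  have hmul : Integrable fun x =>
      cv (sstar A) (sstar B) x * (sstar E).indicator (1 : ℝ → ℝ) x := by
    simpa only [mul_indicator_one_eq_indicator] using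
      hf.indicator (s := sstar E) measurableSet_Ioo
  have hI := integral_mono hf (hmul.add (hi1.add hi2)) hpt
  rw [integral_add' hmul (hi1.add hi2), integral_add' hi1 hi2, hv1, hv2, hint] at hI
  have hI' : lm A * lm B ≤ pr (sstar A) (sstar B) (sstar E) + (τ ^ 2 / 2 + τ ^ 2 / 2) := hI
  linarith

/-- If `(1_A ∗ 1_B) · 1_E + s · 1_F` is dominated by `h + t · 1_E` whenever `h ≥ 0` and
`1_A ∗ 1_B ≤ t + h`, then `s |F|` is at most the deficit of `E` plus the square of the difference between `t` and the level `τ` of `E`. -/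
theorem mul_lm_le_rsD_add_sq {A B E F : Set ℝ} (hA : MeasurableSet A) (hB : MeasurableSet B)
    (hE : MeasurableSet E) (hF : MeasurableSet F) (hAf : volume A ≠ ⊤) (hBf : volume B ≠ ⊤)
    (hEf : volume E ≠ ⊤) (hFf : volume F ≠ ⊤) {s t τ : ℝ} (hτ0 : 0 ≤ τ)
    (hτ : lm E = lm A + lm B - 2 * τ) (h0 : 0 < t) (hAt : t < lm A) (hBt : t < lm B)
    (hdom : ∀ x u : ℝ, 0 ≤ u → cv A B x ≤ t + u →
      cv A B x * E.indicator (1 : ℝ → ℝ) x + s * F.indicator (1 : ℝ → ℝ) x ≤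
        u + t * E.indicator (1 : ℝ → ℝ) x) :
    s * lm F ≤ rsD A B E + (t - τ) ^ 2 := by
  obtain ⟨h, hi, hn, hle, hint⟩ := exists_cv_le_add_cv hA hB hAf hBf h0 hAt hBt
  have hiE := integrable_indicator_one_of_measure_ne_top hE hEf
  have hiF := integrable_indicator_one_of_measure_ne_top hF hFf
  have hmul : Integrable fun x => cv A B x * E.indicator (1 : ℝ → ℝ) x := by
    simpa only [mul_indicator_one_eq_indicator] using
      (cv_integrable hA hB hAf hBf).indicator hE
  have hI := integral_mono (hmul.add (hiF.const_mul s)) (hi.add (hiE.const_mul t))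
    fun x => hdom x (h x) (hn x) (hle x)
  rw [integral_add' hmul (hiF.const_mul s), integral_add' hi (hiE.const_mul t),
    integral_const_mul, integral_const_mul, integral_indicator_one hE,
    integral_indicator_one hF, hint] at hI
  have hI' : pr A B E + s * lm F ≤ (lm A - t) * (lm B - t) + t * lm E := hI
  have hstar := pr_sstar_ge hτ0 hτ
  rw [rsD]
  rw [hτ] at hI'
  nlinarith

/-- Passing from the bound `s d ≤ D + s²`, for all small `s`, to `d ≤ 2 √D`. -/
theorem le_two_mul_sqrt_of_forall_mul_le {d D m : ℝ} (hm : √D < m)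
    (h : ∀ s, 0 < s → s < m → s * d ≤ D + s ^ 2) : d ≤ 2 * √D := by
  rcases le_or_gt D 0 with hD | hD
  · rw [Real.sqrt_eq_zero_of_nonpos hD] at hm ⊢
    by_contra! hd
    have hs : 0 < min (m / 2) (d / 2) := lt_min (by linarith) (by linarith)
    have h1 := h _ hs ((min_le_left _ _).trans_lt (by linarith))
    nlinarith [min_le_right (m / 2) (d / 2)]
  · have hs := Real.sqrt_pos.2 hD
    have h1 := h _ hs hm
    have h2 := Real.sq_sqrt hD.le
    nlinarith

/-- Near-extremal sets nearly coincide with a superlevel set. -/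
theorem near_extremal_superlevel_approx (A B E : Set ℝ)
    (hA : MeasurableSet A) (hB : MeasurableSet B) (hE : MeasurableSet E)
    (hA0 : 0 < volume A) (hAf : volume A ≠ ⊤)
    (hB0 : 0 < volume B) (hBf : volume B ≠ ⊤)
    (hE0 : 0 < volume E) (hEf : volume E ≠ ⊤)
    (hlo : |lm A - lm B| + 2 * Real.sqrt (rsD A B E) < lm E)
    (hhi : lm E < lm A + lm B - 2 * Real.sqrt (rsD A B E))
    (τ : ℝ) (hτ : lm E = lm A + lm B - 2*τ) :
    lm (symmDiff (slev A B τ) E) ≤ 4 * Real.sqrt (rsD A B E) ∧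
    |lm (slev A B τ) - (lm A + lm B - 2*τ)| ≤ 4 * Real.sqrt (rsD A B E) := by
  have hσ := Real.sqrt_nonneg (rsD A B E)
  set σ := √(rsD A B E)
  have hab := abs_lt.1 (show |lm A - lm B| < lm E - 2 * σ by linarith)
  have hτ0 : 0 < τ := by linarith
  set S := slev A B τ
  have hSm : MeasurableSet S := measurableSet_lt measurable_const (measurable_cv hA hB)
  have hSf : volume S ≠ ⊤ := ((cv_integrable hA hB hAf hBf).measure_gt_lt_top hτ0).ne
  have hSEf : volume (S \ E) ≠ ⊤ := measure_ne_top_of_subset sdiff_subset hSf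
  have hESf : volume (E \ S) ≠ ⊤ := measure_ne_top_of_subset sdiff_subset hEf
  have h1 : lm (S \ E) ≤ 2 * σ := by
    refine le_two_mul_sqrt_of_forall_mul_le (m := τ) (by linarith) fun s hs hsτ => ?_
    have := mul_lm_le_rsD_add_sq (s := s) (t := τ - s) hA hB hE (hSm.diff hE) hAf hBf hEf hSEf
      hτ0.le hτ (by linarith) (by linarith) (by linarith) fun x u hu hxu => by
        by_cases hxE : x ∈ E
        · simp only [indicator, hxE, Set.mem_sdiff, not_true_eq_false, and_false, if_true, if_false,
            Pi.one_apply]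
          linarith
        · by_cases hxS : x ∈ S
          · have : τ < cv A B x := hxS
            simp only [indicator, hxE, hxS, Set.mem_sdiff, not_false_eq_true, and_true, if_true,
              if_false, Pi.one_apply]
            linarith
          · simp only [indicator, hxE, hxS, Set.mem_sdiff, false_and, if_false]
            linarith
    linarith [show (τ - s - τ) ^ 2 = s ^ 2 by ring]
  have h2 : lm (E \ S) ≤ 2 * σ := by
    refine le_two_mul_sqrt_of_forall_mul_le (m := min (lm A) (lm B) - τ)
      (lt_sub_iff_add_lt.2 (lt_min (by linarith) (by linarith))) fun s hs hsm => ?_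
    have hsA := min_le_left (lm A) (lm B)
    have hsB := min_le_right (lm A) (lm B)
    have := mul_lm_le_rsD_add_sq (s := s) (t := τ + s) hA hB hE (hE.diff hSm) hAf hBf hEf hESf
      hτ0.le hτ (by linarith) (by linarith) (by linarith) fun x u hu hxu => by
        by_cases hxE : x ∈ E
        · by_cases hxS : x ∈ S
          · simp only [indicator, hxE, hxS, Set.mem_sdiff, not_true_eq_false, and_false, if_true,
              if_false, Pi.one_apply]
            linarith
          · have : cv A B x ≤ τ := not_lt.1 hxS
            simp only [indicator, hxE, hxS, Set.mem_sdiff, not_false_eq_true, and_true, if_true,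
              Pi.one_apply]
            linarith
        · simp only [indicator, hxE, Set.mem_sdiff, false_and, if_false]
          linarith
    linarith [show (τ + s - τ) ^ 2 = s ^ 2 by ring]
  have hSsplit := lm_inter_add_diff hE hSf
  have hEsplit := lm_inter_add_diff hSm hEf
  rw [inter_comm] at hEsplit
  have hd1 : 0 ≤ lm (S \ E) := ENNReal.toReal_nonneg
  have hd2 : 0 ≤ lm (E \ S) := ENNReal.toReal_nonneg
  refine ⟨(lm_union_le (S \ E) (E \ S)).trans (by linarith), ?_⟩
  rw [← hτ]
  exact abs_le.2 ⟨by linarith, by linarith⟩
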